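/- Let M₅ be the Turing machine with states {A,B,C,D,E,F,H} and symbols {0,1} whose transition table is: δ(A,0)=(1,R,B), δ(A,1)=(0,L,D); δ(B,0)=(1,R,C), δ(B,1)=(0,R,F); δ(C,0)=(1,L,C), δ(C,1)=(1,L,A); δ(D,0)=(0,L,E), δ(D,1)=(1,R,H); δ(E,0)=(1,L,A), δ(E,1)=(0,R,B); δ(F,0)=(0,R,C), δ(F,1)=(0,R,E). Let C(k,n) = ^ω0 1 0^n 1 (C1) 1^{3k} 0^ω. Then for every n ≥ 0 and every r with 0 ≤ r ≤ 3: C(2, 4n+r) ⊢(t_n) C(u_n, r), where u_n = (3^{n+2} − 5)/2 and t_n = (3·9^{n+3} − 80·3^{n+3} + 584n − 27)/32 (both integers). -/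

import Mathlib

open Turing

inductive TSt where | A | B | C | D | E | F | H
deriving DecidableEq

inductive Gam where | s0 | s1
deriving DecidableEq

instance : Inhabited Gam := ⟨Gam.s0⟩

abbrev Cfg := TSt × Tape Gam

/-- The transition table of the machine (values from the halting state `H` are never used). -/
def delta : TSt → Gam → Gam × Dir × TSt
  | .A, .s0 => (.s1, Dir.right, .B)
  | .A, .s1 => (.s0, Dir.left, .D)
  | .B, .s0 => (.s1, Dir.right, .C)
  | .B, .s1 => (.s0, Dir.right, .F)
  | .C, .s0 => (.s1, Dir.left, .C)
  | .C, .s1 => (.s1, Dir.left, .A)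
  | .D, .s0 => (.s0, Dir.left, .E)
  | .D, .s1 => (.s1, Dir.right, .H)
  | .E, .s0 => (.s1, Dir.left, .A)
  | .E, .s1 => (.s0, Dir.right, .B)
  | .F, .s0 => (.s0, Dir.right, .C)
  | .F, .s1 => (.s0, Dir.right, .E)
  | .H, a => (a, Dir.right, .H)

/-- One computation step; `none` if the current state is the halting state `H`. -/
def step (c : Cfg) : Option Cfg :=
  if c.1 = TSt.H then none
  else
    let t := delta c.1 c.2.head
    some (t.2.2, (c.2.write t.1).move t.2.1)

/-- `reaches t c₁ c₂` : iterating `step` exactly `t` times starting from `c₁` yields `c₂`. -/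
def reaches (t : ℕ) (c₁ c₂ : Cfg) : Prop :=
  (fun c => Option.bind c step)^[t] (some c₁) = some c₂

/-- The configuration `^ω0 x (q a) y 0^ω` : state `q`, head reading `a`, the word `x`
written immediately to the left of the head (in order), `y` immediately to the right,
blank elsewhere. -/
def mkCfg (x : List Gam) (q : TSt) (a : Gam) (y : List Gam) : Cfg :=
  (q, ⟨a, ListBlank.mk x.reverse, ListBlank.mk y⟩)

/-- `C(k,n) = ^ω0 1 0^n 1 (C1) 1^{3k} 0^ω`. -/
def Cfg5 (k n : ℕ) : Cfg :=
  mkCfg ([.s1] ++ List.replicate n .s0 ++ [.s1]) .C .s1 (List.replicate (3*k) .s1)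

theorem reaches.trans {s t : ℕ} {a b c : Cfg} (h₁ : reaches s a b) (h₂ : reaches t b c) :
    reaches (s + t) a c := by
  unfold reaches at *
  rw [add_comm, Function.iterate_add_apply, h₁, h₂]

theorem reaches.refl (a : Cfg) : reaches 0 a a := rfl

theorem reaches.congr_time {s t : ℕ} {a b : Cfg} (h : reaches s a b) (e : s = t) :
    reaches t a b := e ▸ h

/-- `rep s n X` is the half-tape `X` with `n` copies of `s` put in front of it. -/
def rep (s : Gam) : ℕ → ListBlank Gam → ListBlank Gam
  | 0, X => X
  | n + 1, X => (rep s n X).cons s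

theorem rep_cons (s : Gam) (n : ℕ) (X : ListBlank Gam) :
    rep s n (X.cons s) = (rep s n X).cons s := by
  induction n with
  | zero => rfl
  | succ n ih => simp [rep, ih]

theorem mk_replicate_append (s : Gam) (n : ℕ) (l : List Gam) :
    ListBlank.mk (List.replicate n s ++ l) = rep s n (ListBlank.mk l) := by
  induction n with
  | zero => rfl
  | succ n ih => rw [List.replicate_succ, List.cons_append, ← ListBlank.cons_mk, ih, rep]

/-- The blank half-tape. -/
def blanks : ListBlank Gam := ListBlank.mk []

theorem head_blanks : blanks.head = Gam.s0 := rfl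

theorem tail_blanks : blanks.tail = blanks := rfl

theorem reaches_zero_iff (a b : Cfg) : reaches 0 a b ↔ a = b := by
  simp [reaches]

theorem reaches_succ_iff {t : ℕ} {q : TSt} {a : Gam} {L R : ListBlank Gam} {c : Cfg}
    (hq : q ≠ TSt.H) :
    reaches (t + 1) (q, ⟨a, L, R⟩) c ↔
      reaches t ((delta q a).2.2, Tape.move (delta q a).2.1 ⟨(delta q a).1, L, R⟩) c := by
  simp [reaches, step, hq, Tape.write]

/-- The states `B`, `F`, `E` erase a block of ones three at a time, moving right. -/
theorem reaches_erase (j : ℕ) (L X : ListBlank Gam) :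
    reaches (3 * j) (.B, ⟨.s1, L, rep .s1 (3 * j) X⟩) (.B, ⟨.s1, rep .s0 (3 * j) L, X⟩) := by
  induction j generalizing L with
  | zero => exact reaches.refl _
  | succ j ih =>
    have h := ih (((L.cons .s0).cons .s0).cons .s0)
    simp only [rep_cons] at h
    rw [mul_add_one]
    simpa [reaches_succ_iff, delta, Tape.move, rep] using h

/-- The state `C` fills a block of zeros with ones, moving left. -/
theorem reaches_fill (m : ℕ) (L X : ListBlank Gam) :
    reaches (m + 1) (.C, ⟨.s0, rep .s0 m (L.cons .s1), X⟩)
      (.C, ⟨.s1, L, rep .s1 (m + 1) X⟩) := by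
  induction m generalizing X with
  | zero =>
    simp [reaches_succ_iff, reaches_zero_iff, delta, Tape.move, rep]
  | succ m ih =>
    have h := ih (X.cons .s1)
    simp only [rep_cons] at h
    simpa [reaches_succ_iff, delta, Tape.move, rep] using h

theorem reaches_sweep (j : ℕ) (L : ListBlank Gam) :
    reaches (6 * j + 6) (.A, ⟨.s0, L, rep .s1 (3 * j + 1) blanks⟩)
      (.C, ⟨.s1, L, rep .s1 (3 * j + 3) blanks⟩) := by
  have h₁ : reaches 1 (.A, ⟨.s0, L, rep .s1 (3 * j + 1) blanks⟩)
      (.B, ⟨.s1, L.cons .s1, rep .s1 (3 * j) blanks⟩) := by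
    simp [reaches_succ_iff, reaches_zero_iff, delta, Tape.move, rep]
  have h₂ : reaches 2 (.B, ⟨.s1, rep .s0 (3 * j) (L.cons .s1), blanks⟩)
      (.C, ⟨.s0, rep .s0 (3 * j + 2) (L.cons .s1), blanks⟩) := by
    simp [reaches_succ_iff, reaches_zero_iff, delta, Tape.move, rep, head_blanks, tail_blanks]
  exact (((h₁.trans (reaches_erase j _ _)).trans h₂).trans
    (reaches_fill (3 * j + 2) L blanks)).congr_time (by ring)

theorem reaches_sweeps (z j : ℕ) (L : ListBlank Gam) :
    reaches (3 * z ^ 2 + (6 * j + 4) * z)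
      (.A, ⟨.s0, rep .s0 z L, rep .s1 (3 * j + 1) blanks⟩)
      (.A, ⟨.s0, L, rep .s1 (3 * (j + z) + 1) blanks⟩) := by
  induction z generalizing j with
  | zero => exact reaches.refl _
  | succ z ih =>
    have h₁ : reaches 1 (.C, ⟨.s1, rep .s0 (z + 1) L, rep .s1 (3 * j + 3) blanks⟩)
        (.A, ⟨.s0, rep .s0 z L, rep .s1 (3 * (j + 1) + 1) blanks⟩) := by
      simp [reaches_succ_iff, reaches_zero_iff, delta, Tape.move, rep, mul_add_one]
    have h₂ := ih (j + 1)
    rw [show j + 1 + z = j + (z + 1) by ring] at h₂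
    exact (((reaches_sweep j _).trans h₁).trans h₂).congr_time (by ring)

theorem reaches_prefix (k : ℕ) (L : ListBlank Gam) :
    reaches 12 (.C, ⟨.s1, (rep .s0 4 L).cons .s1, rep .s1 (3 * k) blanks⟩)
      (.B, ⟨.s1, L.cons .s1, rep .s1 (3 * (k + 1)) (blanks.cons .s1)⟩) := by
  rw [rep_cons]
  simp [reaches_succ_iff, reaches_zero_iff, delta, Tape.move, rep, mul_add]

theorem reaches_turn (m : ℕ) (L : ListBlank Gam) :
    reaches 10 (.B, ⟨.s1, rep .s0 m L, blanks.cons .s1⟩)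
      (.A, ⟨.s0, rep .s0 m L, rep .s1 4 blanks⟩) := by
  simp [reaches_succ_iff, reaches_zero_iff, delta, Tape.move, rep, head_blanks, tail_blanks]

theorem Cfg5_eq (k n : ℕ) :
    Cfg5 k n = (.C, ⟨.s1, (rep .s0 n (blanks.cons .s1)).cons .s1, rep .s1 (3 * k) blanks⟩) := by
  have h := mk_replicate_append .s1 (3 * k) []
  rw [List.append_nil] at h
  simp [Cfg5, mkCfg, blanks, h, ← ListBlank.cons_mk, mk_replicate_append]

theorem rep_add (s : Gam) (m n : ℕ) (X : ListBlank Gam) :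
    rep s (m + n) X = rep s n (rep s m X) := by
  induction n with
  | zero => rfl
  | succ n ih => rw [← add_assoc, rep, rep, ih]

theorem reaches_Cfg5 (k n : ℕ) :
    reaches (27 * k ^ 2 + 105 * k + 112) (Cfg5 k (n + 4)) (Cfg5 (3 * k + 5) n) := by
  rw [Cfg5_eq, Cfg5_eq, rep_add]
  set L := rep .s0 n (blanks.cons .s1)
  have h₁ := (reaches_prefix k L).trans (reaches_erase (k + 1) _ _)
  have h₂ := h₁.trans (reaches_turn _ _)
  have h₃ := h₂.trans (reaches_sweeps (3 * (k + 1)) 1 _)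
  have h₄ := h₃.trans (reaches_sweep _ _)
  rw [show 3 * (1 + 3 * (k + 1)) + 3 = 3 * (3 * k + 5) by ring] at h₄
  exact h₄.congr_time (by ring)

theorem exists_reaches_Cfg5 (n : ℕ) :
    ∃ u t : ℕ, 3 ^ (n + 2) = 2 * u + 5 ∧
      3 * 9 ^ (n + 3) + 584 * n = 32 * t + 80 * 3 ^ (n + 3) + 27 ∧
      ∀ r, reaches t (Cfg5 2 (4 * n + r)) (Cfg5 u r) := by
  induction n with
  | zero => exact ⟨2, 0, by norm_num, by norm_num, fun r => by simpa using reaches.refl _⟩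
  | succ n ih =>
    obtain ⟨u, t, hu, ht, h⟩ := ih
    refine ⟨3 * u + 5, t + (27 * u ^ 2 + 105 * u + 112), ?_, ?_, fun r => ?_⟩
    · rw [show n + 1 + 2 = (n + 2) + 1 by ring, pow_succ, hu]
      ring
    · have h9 : 9 ^ (n + 2) = (2 * u + 5) ^ 2 := by
        rw [← hu, ← pow_mul, mul_comm, pow_mul]
        norm_num
      have e₁ : 9 ^ (n + 3) = 9 * (2 * u + 5) ^ 2 := by rw [pow_succ, h9, mul_comm]
      have e₂ : 3 ^ (n + 3) = 3 * (2 * u + 5) := by rw [pow_succ, hu, mul_comm]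
      rw [show n + 1 + 3 = (n + 3) + 1 by ring, pow_succ 9 (n + 3), pow_succ 3 (n + 3), e₁, e₂]
      rw [e₁, e₂] at ht
      linarith
    · have h₁ := h (r + 4)
      rw [show 4 * n + (r + 4) = 4 * (n + 1) + r by ring] at h₁
      exact h₁.trans (reaches_Cfg5 u r)

theorem stmt12 :
    ∀ n r : ℕ, r ≤ 3 →
      reaches ((3*9^(n+3) - 80*3^(n+3) + 584*n - 27)/32)
        (Cfg5 2 (4*n + r)) (Cfg5 ((3^(n+2) - 5)/2) r) := by
  intro n r _
  obtain ⟨u, t, hu, ht, h⟩ := exists_reaches_Cfg5 n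
  have hle : 80 * 3 ^ (n + 3) ≤ 3 * 9 ^ (n + 3) := by
    have h9 : 9 ^ (n + 3) = 3 ^ (n + 3) * 3 ^ (n + 3) := by
      rw [← mul_pow]; norm_num
    have h27 : 27 ≤ 3 ^ (n + 3) := by
      rw [pow_add]
      linarith [Nat.one_le_pow n 3 (by norm_num)]
    rw [h9, ← mul_assoc]
    exact Nat.mul_le_mul_right _ (by linarith)
  rw [show (3 ^ (n + 2) - 5) / 2 = u by omega,
    show (3 * 9 ^ (n + 3) - 80 * 3 ^ (n + 3) + 584 * n - 27) / 32 = t by omega]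
  exact h r
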